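/- For every ε > 0 there exists an (effectively computable) D₀ = D₀(ε) such that the following holds: if D > D₀, χ is a real primitive Dirichlet character modulo D, and Assumption (A) holds, then |Σ_{n < D⁴} ν(n)²/n − 𝔞| < ε, where 𝔞 = (6/π²)·L'(1,χ)²·∏_{q | D, q prime} q/(q+1). -/

import Mathlib

open scoped Classical

noncomputable section

/-- The Dirichlet L-function of `χ` (extended to modulus `0` by `0`, a case never used below). -/
def Lfun {N : ℕ} (χ : DirichletCharacter ℂ N) (s : ℂ) : ℂ :=
  if h : N = 0 then 0
  else
    haveI : NeZero N := ⟨h⟩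
    DirichletCharacter.LFunction χ s

/-- A Dirichlet character is *real* if all of its values are real numbers. -/
def IsRealChar {N : ℕ} (χ : DirichletCharacter ℂ N) : Prop :=
  ∀ a : ZMod N, (χ a).im = 0

/-- `𝓛 = log D`. -/
def bigL (D : ℕ) : ℝ := Real.log D

/-- `P = exp (𝓛 ^ 9)`. -/
def bigP (D : ℕ) : ℝ := Real.exp (bigL D ^ 9)

/-- Assumption (A): `L(1, χ) < 𝓛 ^ (-2022)`. -/
def AssumptionA (D : ℕ) (χ : DirichletCharacter ℂ D) : Prop :=
  (Lfun χ 1).re < bigL D ^ (-2022 : ℤ)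

/-- `p ~ P`, i.e. `p` is a prime with `P < p < P * (1 + 𝓛 ^ (-68))`. -/
def SimP (D p : ℕ) : Prop :=
  p.Prime ∧ bigP D < (p : ℝ) ∧ (p : ℝ) < bigP D * (1 + bigL D ^ (-68 : ℤ))

/-- The finite set of primes `p ~ P`. -/
def primesP (D : ℕ) : Finset ℕ :=
  (Finset.range ⌈2 * bigP D⌉₊).filter (SimP D)

/-- `𝒫 = ∑_{p ~ P} p`. -/
def calP (D : ℕ) : ℝ := ∑ p ∈ primesP D, (p : ℝ)

/-- `ν(n) = ∑_{d ∣ n} χ(d)`. -/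
def nuF (D : ℕ) (χ : DirichletCharacter ℂ D) (n : ℕ) : ℂ :=
  ∑ d ∈ n.divisors, χ (d : ZMod D)

/-- `υ(n) = ∑_{ab = n} μ(a) μ(b) χ(b)`. -/
def upsF (D : ℕ) (χ : DirichletCharacter ℂ D) (n : ℕ) : ℂ :=
  ∑ d ∈ n.divisors,
    ((ArithmeticFunction.moebius (n / d) : ℤ) : ℂ) * ((ArithmeticFunction.moebius d : ℤ) : ℂ) *
      χ (d : ZMod D)

/-- `t₀ = 𝓛 ^ 519`. -/
def t0 (D : ℕ) : ℝ := bigL D ^ 519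

/-- `s₀ = 1/2 + 2 π i t₀`. -/
def s0 (D : ℕ) : ℂ := 1 / 2 + 2 * (Real.pi : ℂ) * Complex.I * (t0 D : ℂ)

/-- `𝓛₁ = 𝓛 ^ 405`. -/
def bigL1 (D : ℕ) : ℝ := bigL D ^ 405

/-- `ν` truncated to `n ≤ D ^ 4`, as an arithmetic function. -/
def nuT (D : ℕ) (χ : DirichletCharacter ℂ D) : ArithmeticFunction ℂ :=
  ⟨fun n => if n = 0 then 0 else if n ≤ D ^ 4 then nuF D χ n else 0, by simp⟩

/-- `υ` truncated to `n ≤ D ^ 4`, as an arithmetic function. -/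
def upsT (D : ℕ) (χ : DirichletCharacter ℂ D) : ArithmeticFunction ℂ :=
  ⟨fun n => if n = 0 then 0 else if n ≤ D ^ 4 then upsF D χ n else 0, by simp⟩

/-- `ν₂₀`, the 20-fold Dirichlet convolution of the truncation of `ν`. -/
def nu20 (D : ℕ) (χ : DirichletCharacter ℂ D) (n : ℕ) : ℂ := (nuT D χ ^ 20) n

/-- `υ₂₀`, the 20-fold Dirichlet convolution of the truncation of `υ`. -/
def ups20 (D : ℕ) (χ : DirichletCharacter ℂ D) (n : ℕ) : ℂ := (upsT D χ ^ 20) n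

/-- `ς(n) = ∑_{lm = n, l ≤ D⁴, m ≤ D⁴} ν(l) υ(m)`. -/
def sigF (D : ℕ) (χ : DirichletCharacter ℂ D) (n : ℕ) : ℂ :=
  ∑ d ∈ n.divisors,
    if d ≤ D ^ 4 ∧ n / d ≤ D ^ 4 then nuF D χ d * upsF D χ (n / d) else 0

/-- `X₁(x, ψ) = ∑_{n ≤ x} ν₂₀(n) ψ(n) n^{-s₀}`. -/
def X1 (D : ℕ) (χ : DirichletCharacter ℂ D) {p : ℕ} (ψ : DirichletCharacter ℂ p) (x : ℝ) : ℂ :=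
  ∑ n ∈ Finset.Icc 1 ⌊x⌋₊, nu20 D χ n * ψ (n : ZMod p) * (n : ℂ) ^ (-s0 D)

/-- `X₂(x, ψ) = ∑_{n ≤ x} υ₂₀(n) ψ(n) n^{-s₀}`. -/
def X2 (D : ℕ) (χ : DirichletCharacter ℂ D) {p : ℕ} (ψ : DirichletCharacter ℂ p) (x : ℝ) : ℂ :=
  ∑ n ∈ Finset.Icc 1 ⌊x⌋₊, ups20 D χ n * ψ (n : ZMod p) * (n : ℂ) ^ (-s0 D)

/-- `X₃(x, ψ) = ∑_{D⁴ < n ≤ x} ν(n) ψ(n) n^{-s₀}`. -/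
def X3 (D : ℕ) (χ : DirichletCharacter ℂ D) {p : ℕ} (ψ : DirichletCharacter ℂ p) (x : ℝ) : ℂ :=
  ∑ n ∈ Finset.Ioc (D ^ 4) ⌊x⌋₊, nuF D χ n * ψ (n : ZMod p) * (n : ℂ) ^ (-s0 D)

/-- `X₄(x, ψ) = ∑_{D⁴ < n ≤ x} ς(n) ψ(n) n^{-s₀}`. -/
def X4 (D : ℕ) (χ : DirichletCharacter ℂ D) {p : ℕ} (ψ : DirichletCharacter ℂ p) (x : ℝ) : ℂ :=
  ∑ n ∈ Finset.Ioc (D ^ 4) ⌊x⌋₊, sigF D χ n * ψ (n : ZMod p) * (n : ℂ) ^ (-s0 D)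

/-- Inequality (3.4). -/
def Ineq1 (D : ℕ) (χ : DirichletCharacter ℂ D) {p : ℕ} (ψ : DirichletCharacter ℂ p) : Prop :=
  ‖X1 D χ ψ ((D : ℝ) ^ 80)‖ + ‖X2 D χ ψ ((D : ℝ) ^ 80)‖ +
      (∫ x in (1 : ℝ)..((D : ℝ) ^ 80), (‖X1 D χ ψ x‖ + ‖X2 D χ ψ x‖) / x) <
    bigL D ^ 1171

/-- Inequality (3.5). -/
def Ineq2 (D : ℕ) (χ : DirichletCharacter ℂ D) {p : ℕ} (ψ : DirichletCharacter ℂ p) : Prop :=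
  ‖X3 D χ ψ (bigP D ^ 2)‖ + (∫ x in ((D : ℝ) ^ 4)..(bigP D ^ 2), ‖X3 D χ ψ x‖ / x) <
    bigL D ^ (-585 : ℤ)

/-- Inequality (3.6). -/
def Ineq3 (D : ℕ) (χ : DirichletCharacter ℂ D) {p : ℕ} (ψ : DirichletCharacter ℂ p) : Prop :=
  ‖X4 D χ ψ ((D : ℝ) ^ 8)‖ + (∫ x in ((D : ℝ) ^ 4)..((D : ℝ) ^ 8), ‖X4 D χ ψ x‖ / x) <
    bigL D ^ (-633 : ℤ)

/-- Membership in `Ψ₁`: `ψ` is a primitive character mod `p` with `p ~ P` satisfying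
(3.4), (3.5) and (3.6). -/
def MemPsi1 (D : ℕ) (χ : DirichletCharacter ℂ D) {p : ℕ} (ψ : DirichletCharacter ℂ p) : Prop :=
  SimP D p ∧ ψ.IsPrimitive ∧ Ineq1 D χ ψ ∧ Ineq2 D χ ψ ∧ Ineq3 D χ ψ

/-- `F(s, ψ) = ∑_{n ≤ D⁴} ν(n) ψ(n) n^{-s}`. -/
def Ffun (D : ℕ) (χ : DirichletCharacter ℂ D) {p : ℕ} (ψ : DirichletCharacter ℂ p) (s : ℂ) : ℂ :=
  ∑ n ∈ Finset.Icc 1 (D ^ 4), nuF D χ n * ψ (n : ZMod p) * (n : ℂ) ^ (-s)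

/-- `G(s, ψ) = ∑_{n ≤ D⁴} υ(n) ψ(n) n^{-s}`. -/
def Gfun (D : ℕ) (χ : DirichletCharacter ℂ D) {p : ℕ} (ψ : DirichletCharacter ℂ p) (s : ℂ) : ℂ :=
  ∑ n ∈ Finset.Icc 1 (D ^ 4), upsF D χ n * ψ (n : ZMod p) * (n : ℂ) ^ (-s)

/-- `F'(s, ψ) = -∑_{n ≤ D⁴} ν(n) ψ(n) (log n) n^{-s}`, the derivative of `F` in `s`. -/
def Ffun' (D : ℕ) (χ : DirichletCharacter ℂ D) {p : ℕ} (ψ : DirichletCharacter ℂ p) (s : ℂ) : ℂ :=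
  -∑ n ∈ Finset.Icc 1 (D ^ 4),
    nuF D χ n * ψ (n : ZMod p) * ((Real.log n : ℝ) : ℂ) * (n : ℂ) ^ (-s)

/-- `F(1 - s, ψ̄) = ∑_{n ≤ D⁴} ν(n) conj(ψ(n)) n^{s - 1}`, as a function of `s`. -/
def FfunBar (D : ℕ) (χ : DirichletCharacter ℂ D) {p : ℕ} (ψ : DirichletCharacter ℂ p)
    (s : ℂ) : ℂ :=
  ∑ n ∈ Finset.Icc 1 (D ^ 4),
    nuF D χ n * (starRingEnd ℂ) (ψ (n : ZMod p)) * (n : ℂ) ^ (s - 1)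

/-- The region `Ω`. -/
def InOmega (D : ℕ) (s : ℂ) : Prop :=
  |(s - s0 D).re| < 1 / 2 ∧ |(s - s0 D).im| < bigL1 D + 2

/-- The region `Ω₁`. -/
def InOmega1 (D : ℕ) (s : ℂ) : Prop :=
  1 / 2 - Real.log (bigL D) / (100 * bigL D) < s.re ∧
    s.re < 1 + Real.log (bigL D) / (100 * bigL D) ∧
    |s.im - 2 * Real.pi * t0 D| < bigL1 D + 5

/-- The region `Ω₂`. -/
def InOmega2 (D : ℕ) (s : ℂ) : Prop :=
  1 / 2 - (bigL D)⁻¹ < s.re ∧ s.re < 1 + (bigL D)⁻¹ ∧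
    |s.im - 2 * Real.pi * t0 D| < bigL1 D + 4

/-- `α = π / log P`. -/
def alphaD (D : ℕ) : ℝ := Real.pi / Real.log (bigP D)

/-- The region `Ω₃`. -/
def InOmega3 (D : ℕ) (s : ℂ) : Prop :=
  1 / 2 - alphaD D < s.re ∧ s.re < 1 + alphaD D ∧
    |s.im - 2 * Real.pi * t0 D| < bigL1 D + 3

/-- The Gauss sum `τ(θ) = ∑_{a mod k} θ(a) e(a/k)`. -/
def tauSum {k : ℕ} (θ : DirichletCharacter ℂ k) : ℂ :=
  ∑ a ∈ Finset.range k,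
    θ (a : ZMod k) * Complex.exp (2 * (Real.pi : ℂ) * Complex.I * (a : ℂ) / (k : ℂ))

/-- The factor `Z(s, θ)` from the functional equation. -/
def Zfun {k : ℕ} (θ : DirichletCharacter ℂ k) (s : ℂ) : ℂ :=
  if θ (-1) = 1 then
    tauSum θ * (Real.pi : ℂ) ^ (s - 1 / 2) * (k : ℂ) ^ (-s) *
      Complex.Gamma ((1 - s) / 2) / Complex.Gamma (s / 2)
  else
    -Complex.I * tauSum θ * (Real.pi : ℂ) ^ (s - 1 / 2) * (k : ℂ) ^ (-s) *
      Complex.Gamma ((2 - s) / 2) / Complex.Gamma ((1 + s) / 2)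

/-- The product character `χψ` modulo `D * p`, i.e. `n ↦ χ(n) ψ(n)`. -/
def chiPsi (D : ℕ) (χ : DirichletCharacter ℂ D) {p : ℕ} (ψ : DirichletCharacter ℂ p) :
    DirichletCharacter ℂ (D * p) :=
  DirichletCharacter.changeLevel (dvd_mul_right D p) χ *
    DirichletCharacter.changeLevel (dvd_mul_left p D) ψ

/-- `Z̃(s, ψ) = Z(s, ψ) Z(s, χψ)`. -/
def Ztilde (D : ℕ) (χ : DirichletCharacter ℂ D) {p : ℕ} (ψ : DirichletCharacter ℂ p)
    (s : ℂ) : ℂ :=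
  Zfun ψ s * Zfun (chiPsi D χ ψ) s

/-- `T = exp (𝓛 ^ 1.1)`. -/
def bigT (D : ℕ) : ℝ := Real.exp (bigL D ^ (1.1 : ℝ))

/-- `P₄ = P T⁻² t₀`. -/
def P4 (D : ℕ) : ℝ := bigP D * bigT D ^ (-2 : ℤ) * t0 D

/-- The smooth weight `g(x) = π^{-1/2} ∫_{-∞}^{𝓛^{15} log x} e^{-u²} du`. -/
def gfun (D : ℕ) (x : ℝ) : ℝ :=
  Real.pi ^ (-(1 : ℝ) / 2) * ∫ u in Set.Iio (bigL D ^ 15 * Real.log x), Real.exp (-u ^ 2)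

/-- `g*(y) = g(y)` for `y > 1/2`, and `0` otherwise. -/
def gstar (D : ℕ) (y : ℝ) : ℝ := if 1 / 2 < y then gfun D y else 0

/-- `K(s, ψ) = ∑_n ψ(n) n^{-s} g*(P₄ / n)`. -/
def Kfun (D : ℕ) {p : ℕ} (ψ : DirichletCharacter ℂ p) (s : ℂ) : ℂ :=
  ∑' n : ℕ, ψ (n : ZMod p) * (n : ℂ) ^ (-s) * ((gstar D (P4 D / n) : ℝ) : ℂ)

/-- `N(1 - s, ψ̄) = ∑_n conj(ψ(n)) n^{s-1} g*(T² / n)`, as a function of `s`. -/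
def Nfun (D : ℕ) {p : ℕ} (ψ : DirichletCharacter ℂ p) (s : ℂ) : ℂ :=
  ∑' n : ℕ,
    (starRingEnd ℂ) (ψ (n : ZMod p)) * (n : ℂ) ^ (s - 1) * ((gstar D (bigT D ^ 2 / n) : ℝ) : ℂ)

/-- `𝔞 = (6/π²) L'(1,χ)² ∏_{q ∣ D} q/(q+1)`. -/
def fraka (D : ℕ) (χ : DirichletCharacter ℂ D) : ℂ :=
  6 / (Real.pi : ℂ) ^ 2 * deriv (Lfun χ) 1 ^ 2 * ∏ q ∈ D.primeFactors, (q : ℂ) / ((q : ℂ) + 1)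


theorem abel_bound (c f : ℕ → ℝ) (M : ℝ) (hM : ∀ n, |∑ i ∈ Finset.range n, c i| ≤ M)
    (a b : ℕ) (hab : a ≤ b) (hf : ∀ i j, a ≤ i → i ≤ j → f j ≤ f i) (hf0 : ∀ i, a ≤ i → 0 ≤ f i) :
    |∑ i ∈ Finset.Ico a b, c i * f i| ≤ 2 * M * f a := by
  have key : |∑ i ∈ Finset.Ico a b, c i * f i - (∑ i ∈ Finset.range b, c i) * f b
      + (∑ i ∈ Finset.range a, c i) * f a| ≤ M * (f a - f b) := by
    induction b, hab using Nat.le_induction with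
    | base => simp
    | succ n hn ih =>
      rw [Finset.sum_Ico_succ_top hn, Finset.sum_range_succ]
      have h1 := hM (n + 1)
      rw [Finset.sum_range_succ] at h1
      have h2 : 0 ≤ f n - f (n + 1) := sub_nonneg.2 (hf n (n+1) hn (Nat.le_succ n))
      have h3 : |((∑ i ∈ Finset.range n, c i) + c n) * (f n - f (n+1))| ≤ M * (f n - f (n+1)) := by
        rw [abs_mul, abs_of_nonneg h2]
        exact mul_le_mul_of_nonneg_right h1 h2
      rw [abs_le] at *
      constructor <;> nlinarith [h3.1, h3.2, ih.1, ih.2]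
  have hb : |(∑ i ∈ Finset.range b, c i) * f b| ≤ M * f b := by
    rw [abs_mul, abs_of_nonneg (hf0 b hab)]
    exact mul_le_mul_of_nonneg_right (hM b) (hf0 b hab)
  have ha : |(∑ i ∈ Finset.range a, c i) * f a| ≤ M * f a := by
    rw [abs_mul, abs_of_nonneg (hf0 a le_rfl)]
    exact mul_le_mul_of_nonneg_right (hM a) (hf0 a le_rfl)
  rw [abs_le] at *
  constructor <;> linarith [key.1, key.2, ha.1, ha.2, hb.1, hb.2]

/-- partial sums of a nontrivial character -/
theorem char_partial (D : ℕ) [NeZero D] (χ : DirichletCharacter ℂ D) (hχ : χ ≠ 1) (n : ℕ) :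
    ‖∑ i ∈ Finset.range n, χ (i : ZMod D)‖ ≤ D := by
  have hper : ∑ i ∈ Finset.range D, χ (i : ZMod D) = 0 := by
    rw [← χ.sum_eq_zero_of_ne_one hχ]
    refine Finset.sum_bij' (fun i _ => (i : ZMod D)) (fun a _ => a.val) ?_ ?_ ?_ ?_ ?_
    · simp
    · intro a _; simpa using ZMod.val_lt a
    · intro i hi; exact ZMod.val_cast_of_lt (by simpa using hi)
    · intro a _; simp
    · simp
  induction n using Nat.strong_induction_on with
  | _ n ih =>
    by_cases h : n ≤ D
    · refine (norm_sum_le _ _).trans ?_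
      calc ∑ i ∈ Finset.range n, ‖χ (i : ZMod D)‖ ≤ ∑ i ∈ Finset.range n, (1 : ℝ) :=
            Finset.sum_le_sum fun i _ => χ.norm_le_one _
        _ ≤ D := by simpa using h
    · obtain ⟨m, rfl⟩ := Nat.exists_eq_add_of_le (not_le.1 h).le
      rw [Finset.sum_range_add, hper, zero_add]
      have := ih m (by have := NeZero.pos D; omega)
      simpa using this

/-- real part of the character -/
def chr (D : ℕ) (χ : DirichletCharacter ℂ D) (n : ℕ) : ℝ := (χ (n : ZMod D)).re

theorem chr_coe {D : ℕ} {χ : DirichletCharacter ℂ D} (h : ∀ a : ZMod D, (χ a).im = 0) (n : ℕ) :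
    χ (n : ZMod D) = (chr D χ n : ℂ) := by
  apply Complex.ext <;> simp [chr, h]

theorem chr_abs_le {D : ℕ} (χ : DirichletCharacter ℂ D) (n : ℕ) : |chr D χ n| ≤ 1 :=
  (Complex.abs_re_le_norm _).trans (χ.norm_le_one _)

theorem chr_partial (D : ℕ) [NeZero D] (χ : DirichletCharacter ℂ D) (hχ : χ ≠ 1) (n : ℕ) :
    |∑ i ∈ Finset.range n, chr D χ i| ≤ D := by
  have : ∑ i ∈ Finset.range n, chr D χ i = (∑ i ∈ Finset.range n, χ (i : ZMod D)).re := by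
    simp [chr]
  rw [this]
  exact (Complex.abs_re_le_norm _).trans (char_partial D χ hχ n)

theorem hasSum_L {D : ℕ} [NeZero D] {χ : DirichletCharacter ℂ D} 
    (h : ∀ a : ZMod D, (χ a).im = 0) (s : ℝ) (hs : 1 < s) :
    HasSum (fun n : ℕ => ((chr D χ n * ((n : ℝ) ^ s)⁻¹ : ℝ) : ℂ)) (DirichletCharacter.LFunction χ s) := by
  have hs' : 1 < (s : ℂ).re := by simpa
  rw [DirichletCharacter.LFunction_eq_LSeries χ hs']
  have := (ZMod.LSeriesSummable_of_one_lt_re (χ ·) hs').hasSum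
  change HasSum _ (∑' n, LSeries.term (fun x : ℕ => χ (x : ZMod D)) s n)
  convert this using 1
  ext n
  rw [LSeries.term_def]
  split_ifs with hn
  · subst hn; simp [Real.zero_rpow (by linarith : s ≠ 0)]
  · rw [chr_coe h n, Complex.ofReal_mul, Complex.ofReal_inv, Complex.ofReal_cpow (by positivity)]
    simp [div_eq_mul_inv]

theorem hasSum_L' {D : ℕ} [NeZero D] {χ : DirichletCharacter ℂ D} 
    (h : ∀ a : ZMod D, (χ a).im = 0) (s : ℝ) (hs : 1 < s) :
    HasSum (fun n : ℕ => ((chr D χ n * (Real.log n / (n : ℝ) ^ s) : ℝ) : ℂ))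
      (-deriv (DirichletCharacter.LFunction χ) s) := by
  have hs' : 1 < (s : ℂ).re := by simpa
  have hab : LSeries.abscissaOfAbsConv (fun n : ℕ => χ (n : ZMod D)) < (s : ℂ).re := by
    refine lt_of_le_of_lt (LSeries.abscissaOfAbsConv_le_of_le_const ⟨1, fun n _ => χ.norm_le_one _⟩) ?_
    exact_mod_cast hs'
  rw [DirichletCharacter.deriv_LFunction_eq_deriv_LSeries χ hs', LSeries_deriv hab, neg_neg]
  have := (LSeriesSummable_logMul_of_lt_re hab).hasSum
  change HasSum _ (∑' n, LSeries.term (LSeries.logMul fun x : ℕ => χ (x : ZMod D)) s n)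
  convert this using 1
  ext n
  rw [LSeries.term_def]
  split_ifs with hn
  · subst hn; simp
  · rw [LSeries.logMul, chr_coe h n, Complex.ofReal_mul, Complex.ofReal_div, Complex.ofReal_cpow (by positivity)]
    simp
    ring


open Filter Topology in
theorem im_tendsto_zero (F : ℂ → ℂ) (hF : ContinuousAt F 1) (h : ∀ s : ℝ, 1 < s → (F s).im = 0) :
    (F 1).im = 0 := by
  have hc : Tendsto (fun s : ℝ => (F s).im) (𝓝[>] 1) (𝓝 (F 1).im) := by
    have h1 : Tendsto (fun s : ℝ => (s : ℂ)) (𝓝[>] 1) (𝓝 1) := by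
      have := (Complex.continuous_ofReal.tendsto 1)
      simp only [Complex.ofReal_one] at this
      exact this.mono_left nhdsWithin_le_nhds
    exact (Complex.continuous_im.tendsto _).comp (Tendsto.comp hF h1)
  have : (fun s : ℝ => (F s).im) =ᶠ[𝓝[>] 1] fun _ => 0 := by
    filter_upwards [self_mem_nhdsWithin] with s hs using h s hs
  exact tendsto_nhds_unique hc ((tendsto_congr' this).2 tendsto_const_nhds)

open Filter Topology in
theorem re_tendsto (F : ℂ → ℂ) (hF : ContinuousAt F 1)  :
    Tendsto (fun s : ℝ => (F s).re) (𝓝[>] 1) (𝓝 (F 1).re) := by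
  have h1 : Tendsto (fun s : ℝ => (s : ℂ)) (𝓝[>] 1) (𝓝 1) := by
    have := (Complex.continuous_ofReal.tendsto 1)
    simp only [Complex.ofReal_one] at this
    exact this.mono_left nhdsWithin_le_nhds
  exact (Complex.continuous_re.tendsto _).comp (Tendsto.comp hF h1)

open Filter Topology in
/-- A general limiting form of the tail estimate. -/
theorem tail_limit (c : ℕ → ℝ) (M : ℝ) (hM : ∀ n, |∑ i ∈ Finset.range n, c i| ≤ M)
    (g : ℝ → ℕ → ℝ) (F : ℂ → ℂ) (hF : ContinuousAt F 1)
    (hsum : ∀ s : ℝ, 1 < s → HasSum (fun n : ℕ => ((c n * g s n : ℝ) : ℂ)) (F s))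
    (a : ℕ) (hg : ∀ s : ℝ, 1 < s → ∀ i j, a ≤ i → i ≤ j → g s j ≤ g s i)
    (hg0 : ∀ s : ℝ, 1 < s → ∀ i, a ≤ i → 0 ≤ g s i)
    (hc : ∀ n, Tendsto (fun s => c n * g s n) (𝓝[>] 1) (𝓝 (c n * g 1 n)))
    (hca : Tendsto (fun s => g s a) (𝓝[>] 1) (𝓝 (g 1 a))) :
    |(F 1).re - ∑ i ∈ Finset.range a, c i * g 1 i| ≤ 2 * M * g 1 a := by
  have h1 : ∀ s : ℝ, 1 < s → |(F s).re - ∑ i ∈ Finset.range a, c i * g s i| ≤ 2 * M * g s a := by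
    intro s hs
    have h2 := (Complex.hasSum_re (hsum s hs)).tendsto_sum_nat
    simp only [Complex.ofReal_re] at h2
    refine le_of_tendsto ((h2.sub_const (∑ i ∈ Finset.range a, c i * g s i)).abs) ?_
    filter_upwards [eventually_ge_atTop a] with N hN
    rw [← Finset.sum_Ico_eq_sub _ hN]
    exact abel_bound c (g s) M hM a N hN (hg s hs) (hg0 s hs)
  refine le_of_tendsto_of_tendsto (((re_tendsto F hF).sub (tendsto_finsetSum _ fun i _ => hc i)).abs)
    (hca.const_mul (2 * M)) ?_
  filter_upwards [self_mem_nhdsWithin] with s hs using h1 s hs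

open Filter Topology in
theorem L_one_approx {D : ℕ} [NeZero D] {χ : DirichletCharacter ℂ D} (hχ : χ ≠ 1)
    (h : ∀ a : ZMod D, (χ a).im = 0) (a : ℕ) (ha : 1 ≤ a) :
    |(DirichletCharacter.LFunction χ 1).re - ∑ i ∈ Finset.range a, chr D χ i * (i : ℝ)⁻¹|
      ≤ 2 * D * (a : ℝ)⁻¹ := by
  have := tail_limit (chr D χ) D (chr_partial D χ hχ) (fun s n => ((n : ℝ) ^ s)⁻¹)
    (DirichletCharacter.LFunction χ) (DirichletCharacter.differentiable_LFunction hχ).continuous.continuousAt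
    (hasSum_L h) a ?_ ?_ ?_ ?_
  · simpa using this
  · intro s hs i j hi hj
    have : (0 : ℝ) < i := by exact_mod_cast (by omega : 0 < i)
    have : (i : ℝ) ≤ j := by exact_mod_cast hj
    gcongr
  · intro s hs i hi; positivity
  · intro n
    rcases Nat.eq_zero_or_pos n with rfl | hn
    · have : (fun s : ℝ => chr D χ 0 * (((0 : ℕ) : ℝ) ^ s)⁻¹) =ᶠ[𝓝[>] 1] fun _ => 0 := by
        filter_upwards [self_mem_nhdsWithin] with s hs
        have : s ≠ 0 := by have : (1 : ℝ) < s := hs; linarith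
        simp [Real.zero_rpow this]
      refine (tendsto_congr' this).2 ?_
      simp
    · have hn' : (0 : ℝ) < n := by exact_mod_cast hn
      have : ContinuousAt (fun s : ℝ => chr D χ n * (((n : ℕ) : ℝ) ^ s)⁻¹) 1 := by
        refine continuousAt_const.mul (ContinuousAt.inv₀ (Real.continuousAt_const_rpow hn'.ne') (by positivity))
      exact this.tendsto.mono_left nhdsWithin_le_nhds
  · have hn' : (0 : ℝ) < a := by exact_mod_cast ha
    have : ContinuousAt (fun s : ℝ => (((a : ℕ) : ℝ) ^ s)⁻¹) 1 := 
      (ContinuousAt.inv₀ (Real.continuousAt_const_rpow hn'.ne') (by positivity))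
    exact this.tendsto.mono_left nhdsWithin_le_nhds

theorem deriv_cont {D : ℕ} [NeZero D] {χ : DirichletCharacter ℂ D} (hχ : χ ≠ 1) :
    Continuous (deriv (DirichletCharacter.LFunction χ)) :=
  ((DirichletCharacter.differentiable_LFunction hχ).contDiff (n := 1)).continuous_deriv le_rfl

open Filter Topology in
theorem L'_one_approx {D : ℕ} [NeZero D] {χ : DirichletCharacter ℂ D} (hχ : χ ≠ 1)
    (h : ∀ a : ZMod D, (χ a).im = 0) (a : ℕ) (ha : 3 ≤ a) :
    |-(deriv (DirichletCharacter.LFunction χ) 1).re -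
      ∑ i ∈ Finset.range a, chr D χ i * (Real.log i / i)|
      ≤ 2 * D * (Real.log a / a) := by
  have := tail_limit (chr D χ) D (chr_partial D χ hχ) (fun s n => (Real.log n / (n : ℝ) ^ s))
    (fun s => - deriv (DirichletCharacter.LFunction χ) s) (deriv_cont hχ).neg.continuousAt
    (hasSum_L' h) a ?_ ?_ ?_ ?_
  · simpa using this
  · intro s hs i j hi hj
    have h3 : (3 : ℝ) ≤ i := by exact_mod_cast (by omega : 3 ≤ i)
    have hij : (i : ℝ) ≤ j := by exact_mod_cast hj
    have he : Real.exp s⁻¹ ≤ 3 := by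
      refine (Real.exp_le_exp.2 (?_ : s⁻¹ ≤ 1)).trans (by linarith [Real.exp_one_lt_d9])
      exact inv_le_one_of_one_le₀ hs.le
    exact Real.log_div_self_rpow_antitoneOn (by linarith : 0 < s) (he.trans h3)
      (he.trans (h3.trans hij)) hij
  · intro s hs i hi; positivity
  · intro n
    rcases Nat.eq_zero_or_pos n with rfl | hn
    · simp
    · have hn' : (0 : ℝ) < n := by exact_mod_cast hn
      have : ContinuousAt (fun s : ℝ => chr D χ n * (Real.log n / ((n : ℕ) : ℝ) ^ s)) 1 := by
        refine continuousAt_const.mul (ContinuousAt.div continuousAt_const (Real.continuousAt_const_rpow hn'.ne') (by positivity))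
      exact this.tendsto.mono_left nhdsWithin_le_nhds
  · have hn' : (0 : ℝ) < a := by exact_mod_cast (by omega : 0 < a)
    have : ContinuousAt (fun s : ℝ => (Real.log a / ((a : ℕ) : ℝ) ^ s)) 1 := 
      (ContinuousAt.div continuousAt_const (Real.continuousAt_const_rpow hn'.ne') (by positivity))
    exact this.tendsto.mono_left nhdsWithin_le_nhds

theorem L_im {D : ℕ} [NeZero D] {χ : DirichletCharacter ℂ D} (hχ : χ ≠ 1)
    (h : ∀ a : ZMod D, (χ a).im = 0) : (DirichletCharacter.LFunction χ 1).im = 0 := by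
  refine im_tendsto_zero _ (DirichletCharacter.differentiable_LFunction hχ).continuous.continuousAt ?_
  intro s hs
  have := Complex.hasSum_im (hasSum_L h s hs)
  simp only [Complex.ofReal_im] at this
  exact this.unique hasSum_zero

theorem L'_im {D : ℕ} [NeZero D] {χ : DirichletCharacter ℂ D} (hχ : χ ≠ 1)
    (h : ∀ a : ZMod D, (χ a).im = 0) : (deriv (DirichletCharacter.LFunction χ) 1).im = 0 := by
  refine im_tendsto_zero _ (deriv_cont hχ).continuousAt ?_
  intro s hs
  have := Complex.hasSum_im (hasSum_L' h s hs)
  simp only [Complex.ofReal_im] at this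
  simpa using this.unique hasSum_zero

theorem sq_eq_one_of_real {D : ℕ} {χ : DirichletCharacter ℂ D} 
    (h : ∀ a : ZMod D, (χ a).im = 0) : χ ^ 2 = 1 := by
  refine MulChar.ext fun a => ?_
  have h1 : ‖χ (a : ZMod D)‖ = 1 := χ.unit_norm_eq_one a
  have h2 : χ (a : ZMod D) = ((χ a).re : ℂ) := by apply Complex.ext <;> simp [h]
  rw [MulChar.pow_apply_coe, MulChar.one_apply_coe]
  rw [h2] at h1 ⊢
  rw [Complex.norm_real, Real.norm_eq_abs] at h1
  have h3 : (χ (a : ZMod D)).re ^ 2 = 1 := by rw [← sq_abs, h1]; norm_num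
  exact_mod_cast h3

open ComplexOrder ArithmeticFunction in
theorem L_nonneg {D : ℕ} [NeZero D] {χ : DirichletCharacter ℂ D} (hχ : χ ≠ 1)
    (h : ∀ a : ZMod D, (χ a).im = 0) : 0 ≤ (DirichletCharacter.LFunction χ 1).re := by
  refine ge_of_tendsto (re_tendsto _ (DirichletCharacter.differentiable_LFunction hχ).continuous.continuousAt) ?_
  filter_upwards [self_mem_nhdsWithin] with s hs
  have hs1 : (1 : ℝ) < s := hs
  have hs' : 1 < (s : ℂ).re := by simpa using hs1
  have h1 : LSeries χ.zetaMul s = riemannZeta s * DirichletCharacter.LFunction χ s := by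
    rw [DirichletCharacter.zetaMul, ← coe_mul, LSeries_convolution']
    · rw [χ.LFunction_eq_LSeries hs']
      congr 1
      · simp_rw [← LSeries_zeta_eq_riemannZeta hs', ← natCoe_apply]
      · exact (LSeries_congr χ.apply_eq_toArithmeticFunction_apply _).symm
    · exact LSeriesSummable_zeta_iff.mpr hs'
    · exact (LSeriesSummable_congr _ fun h ↦ (χ.apply_eq_toArithmeticFunction_apply h).symm).mpr <|
        ZMod.LSeriesSummable_of_one_lt_re χ hs'
  have h2 : 0 ≤ LSeries χ.zetaMul s := by
    refine tsum_nonneg fun n => ?_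
    exact LSeries.term_nonneg (DirichletCharacter.zetaMul_nonneg (sq_eq_one_of_real h) n) _ 
  have h3 := riemannZeta_pos_of_one_lt hs1
  rw [h1] at h2
  have h5 := Complex.pos_iff.1 h3
  have h4 := (Complex.nonneg_iff.1 h2).1
  rw [Complex.mul_re, ← h5.2, zero_mul, sub_zero] at h4
  exact (mul_nonneg_iff_of_pos_left h5.1).1 h4

/-- The arithmetic function `f(n)/n`. -/
def wt (f : ArithmeticFunction ℝ) : ArithmeticFunction ℝ := ⟨fun n => f n / n, by simp⟩

theorem wt_apply (f : ArithmeticFunction ℝ) (n : ℕ) : wt f n = f n / n := rfl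

theorem wt_mul (f g : ArithmeticFunction ℝ) : wt (f * g) = wt f * wt g := by
  ext n
  rw [wt_apply, ArithmeticFunction.mul_apply, ArithmeticFunction.mul_apply, Finset.sum_div]
  refine Finset.sum_congr rfl fun x hx => ?_
  rw [wt_apply, wt_apply, ← (Nat.mem_divisorsAntidiagonal.1 hx).1]
  push_cast
  rw [mul_div_mul_comm]

/-- Logarithmic partial sums. -/
def Wsum (f : ArithmeticFunction ℝ) (N : ℕ) : ℝ := ∑ n ∈ Finset.Ioc 0 N, wt f n

theorem wt_nonneg {f : ArithmeticFunction ℝ} (hf : ∀ n, 0 ≤ f n) (n : ℕ) : 0 ≤ wt f n := by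
  rw [wt_apply]; exact div_nonneg (hf n) (by positivity)

theorem Wsum_nonneg {f : ArithmeticFunction ℝ} (hf : ∀ n, 0 ≤ f n) (n : ℕ) : 0 ≤ Wsum f n :=
  Finset.sum_nonneg fun _ _ => wt_nonneg hf _

theorem Wsum_mul_le {f g : ArithmeticFunction ℝ} (hf : ∀ n, 0 ≤ f n) (hg : ∀ n, 0 ≤ g n) (N : ℕ) :
    Wsum (f * g) N ≤ Wsum f N * Wsum g N := by
  rw [Wsum, wt_mul, ArithmeticFunction.sum_Ioc_mul_eq_sum_prod_filter, Wsum, Wsum,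
    Finset.sum_mul_sum, ← Finset.sum_product']
  exact Finset.sum_le_sum_of_subset_of_nonneg (Finset.filter_subset _ _)
    fun x _ _ => mul_nonneg (wt_nonneg hf _) (wt_nonneg hg _)

theorem Wsum_mul_ge {f g : ArithmeticFunction ℝ} (hf : ∀ n, 0 ≤ f n) (hg : ∀ n, 0 ≤ g n)
    (a b N : ℕ) (hab : a * b ≤ N) :
    Wsum f a * Wsum g b ≤ Wsum (f * g) N := by
  rw [Wsum, Wsum, Wsum, wt_mul, ArithmeticFunction.sum_Ioc_mul_eq_sum_prod_filter, 
    Finset.sum_mul_sum, ← Finset.sum_product']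
  refine Finset.sum_le_sum_of_subset_of_nonneg ?_
    fun x _ _ => mul_nonneg (wt_nonneg hf _) (wt_nonneg hg _)
  intro x hx
  simp only [Finset.mem_product, Finset.mem_Ioc, Finset.mem_filter] at hx ⊢
  obtain ⟨⟨h1, h2⟩, h3, h4⟩ := hx
  have h5 : x.1 * x.2 ≤ N := (Nat.mul_le_mul h2 h4).trans hab
  exact ⟨⟨⟨h1, (Nat.le_mul_of_pos_right _ h3).trans h5⟩, h3, (Nat.le_mul_of_pos_left _ h1).trans h5⟩, h5⟩

/-- The real character as an arithmetic function. -/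
def chiA (D : ℕ) (χ : DirichletCharacter ℂ D) : ArithmeticFunction ℝ :=
  ⟨fun n => if n = 0 then 0 else chr D χ n, by simp⟩

/-- `ν` as a real arithmetic function. -/
def nuA (D : ℕ) (χ : DirichletCharacter ℂ D) : ArithmeticFunction ℝ :=
  chiA D χ * (ArithmeticFunction.zeta : ArithmeticFunction ℝ)

theorem nuA_apply (D : ℕ) (χ : DirichletCharacter ℂ D) (n : ℕ) :
    nuA D χ n = ∑ d ∈ n.divisors, chr D χ d := by
  rw [nuA, ArithmeticFunction.coe_mul_zeta_apply]
  refine Finset.sum_congr rfl fun d hd => ?_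
  have : d ≠ 0 := (Nat.pos_of_mem_divisors hd).ne'
  simp [chiA, this]

theorem harmonic_real (n : ℕ) : (harmonic n : ℝ) = ∑ i ∈ Finset.Ioc 0 n, ((i : ℝ))⁻¹ := by
  rw [harmonic_eq_sum_Icc]; push_cast; rfl

theorem Wsum_nuA (D : ℕ) (χ : DirichletCharacter ℂ D) (y : ℕ) :
    Wsum (nuA D χ) y = ∑ d ∈ Finset.Ioc 0 y, chr D χ d * ((harmonic (y / d) : ℝ) / d) := by
  rw [Wsum, nuA, wt_mul, ArithmeticFunction.sum_Ioc_mul_eq_sum_sum]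
  refine Finset.sum_congr rfl fun d hd => ?_
  have : d ≠ 0 := by have := (Finset.mem_Ioc.1 hd).1; omega
  rw [harmonic_real, wt_apply, mul_div_assoc', mul_comm, div_eq_mul_inv, div_eq_mul_inv]
  have h2 : ∑ m ∈ Finset.Ioc 0 (y / d), (wt (ArithmeticFunction.zeta : ArithmeticFunction ℝ)) m =
      ∑ m ∈ Finset.Ioc 0 (y / d), (m : ℝ)⁻¹ := by
    refine Finset.sum_congr rfl fun m hm => ?_
    have : m ≠ 0 := by have := (Finset.mem_Ioc.1 hm).1; omega
    simp [wt_apply, ArithmeticFunction.zeta_apply, this]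
  rw [h2]
  simp [chiA, this]
  ring

theorem harmonic_mono {a b : ℕ} (h : a ≤ b) : (harmonic a : ℝ) ≤ harmonic b := by
  rw [harmonic_real, harmonic_real]
  exact Finset.sum_le_sum_of_subset_of_nonneg (Finset.Ioc_subset_Ioc_right h) fun _ _ _ => by positivity

theorem harmonic_nonneg (a : ℕ) : (0 : ℝ) ≤ harmonic a := by
  rw [harmonic_real]; positivity

theorem harmonic_approx (y d : ℕ) (hd : 0 < d) (hdy : d ≤ y) :
    |(harmonic (y / d) : ℝ) - (Real.log y - Real.log d + Real.eulerMascheroniConstant)| ≤ 2 * d / y := by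
  set n := y / d with hn
  have hn1 : 1 ≤ n := (Nat.one_le_div_iff hd).2 hdy
  have h1 := Real.eulerMascheroniSeq_lt_eulerMascheroniConstant n
  have h2 := Real.eulerMascheroniConstant_lt_eulerMascheroniSeq' n
  rw [Real.eulerMascheroniSeq] at h1
  rw [Real.eulerMascheroniSeq', if_neg (by omega)] at h2
  have hnR : (1 : ℝ) ≤ n := by exact_mod_cast hn1
  have hdR : (0 : ℝ) < d := by exact_mod_cast hd
  have hyR : (0 : ℝ) < y := by exact_mod_cast (by omega : 0 < y)
  have h3 : (n : ℝ) * d ≤ y := by exact_mod_cast Nat.div_mul_le_self y d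
  have h4 : (y : ℝ) ≤ (n + 1) * d := by
    have : y ≤ (n + 1) * d := by rw [mul_comm]; exact (Nat.lt_mul_div_succ y hd).le
    exact_mod_cast this
  have l3 : Real.log n + Real.log d ≤ Real.log y := by
    rw [← Real.log_mul (by positivity) (by positivity)]
    exact Real.log_le_log (by positivity) h3
  have l4 : Real.log y ≤ Real.log (n + 1) + Real.log d := by
    rw [← Real.log_mul (by positivity) (by positivity)]
    exact Real.log_le_log (by positivity) h4
  have l5 : Real.log (n + 1) - Real.log n ≤ 1 / n := by
    rw [← Real.log_div (by positivity) (by positivity)]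
    refine (Real.log_le_sub_one_of_pos (by positivity)).trans (le_of_eq ?_)
    field_simp; ring
  have l6 : 1 / (n : ℝ) ≤ 2 * d / y := by
    rw [div_le_div_iff₀ (by positivity) hyR]
    nlinarith
  rw [abs_le]; constructor <;> linarith

theorem Wsum_nuA_approx {D : ℕ} [NeZero D] {χ : DirichletCharacter ℂ D} (hχ : χ ≠ 1)
    (h : ∀ a : ZMod D, (χ a).im = 0) (y Y : ℕ) (hY : 3 ≤ Y) (hYy : Y ≤ y) :
    |Wsum (nuA D χ) y - (deriv (DirichletCharacter.LFunction χ) 1).re| ≤ 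
      (Real.log y + 1) * ((DirichletCharacter.LFunction χ 1).re + 2 * D / Y)
      + 2 * D * Real.log Y / Y + 2 * Y / y + 2 * D * (Real.log y + 1) / Y := by
  set ℓ := (DirichletCharacter.LFunction χ 1).re with hℓ
  set ℓ' := (deriv (DirichletCharacter.LFunction χ) 1).re with hℓ'
  set γ := Real.eulerMascheroniConstant with hγ
  have hℓ0 : 0 ≤ ℓ := L_nonneg hχ h
  have hYR : (3 : ℝ) ≤ Y := by exact_mod_cast hY
  have hyR : (3 : ℝ) ≤ y := by exact_mod_cast hY.trans hYy
  have hly : 0 ≤ Real.log y := Real.log_nonneg (by linarith)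
  have hsplit : Wsum (nuA D χ) y = 
      ∑ d ∈ Finset.Ico 1 Y, chr D χ d * ((harmonic (y / d) : ℝ) / d) + 
      ∑ d ∈ Finset.Ico Y (y + 1), chr D χ d * ((harmonic (y / d) : ℝ) / d) := by
    rw [Wsum_nuA, Finset.sum_Ico_consecutive _ (by omega) (by omega)]
    rfl
  have htail : |∑ d ∈ Finset.Ico Y (y + 1), chr D χ d * ((harmonic (y / d) : ℝ) / d)|
      ≤ 2 * D * (Real.log y + 1) / Y := by
    refine (abel_bound (chr D χ) (fun d => (harmonic (y / d) : ℝ) / d) D (chr_partial D χ hχ) Y (y+1)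
      (by omega) ?_ ?_).trans ?_
    · intro i j hi hj
      have : (0 : ℝ) < i := by exact_mod_cast (by omega : 0 < i)
      have : (i : ℝ) ≤ j := by exact_mod_cast hj
      have h3 := harmonic_mono (Nat.div_le_div_left (a := y) hj (by omega))
      have h4 := harmonic_nonneg (y / i)
      exact div_le_div₀ h4 h3 (by assumption) (by assumption)
    · intro i _
      exact div_nonneg (harmonic_nonneg _) (by positivity)
    · rw [mul_div_assoc]
      have : (harmonic (y / Y) : ℝ) ≤ Real.log y + 1 := by
        refine (harmonic_mono (Nat.div_le_self y Y)).trans ?_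
        have := harmonic_le_one_add_log y
        linarith
      gcongr
  have hL := L_one_approx hχ h Y (by omega)
  have hL' := L'_one_approx hχ h Y hY
  have r1 : ∀ f : ℕ → ℝ, f 0 = 0 → ∑ i ∈ Finset.range Y, f i = ∑ i ∈ Finset.Ico 1 Y, f i := by
    intro f hf
    rw [Finset.range_eq_Ico, Finset.sum_eq_sum_Ico_succ_bot (by omega), hf, zero_add]
  rw [r1 _ (by simp)] at hL hL'
  have hhead : |∑ d ∈ Finset.Ico 1 Y, chr D χ d * ((harmonic (y / d) : ℝ) / d) -
      ((Real.log y + γ) * ∑ d ∈ Finset.Ico 1 Y, chr D χ d * (d : ℝ)⁻¹ 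
        - ∑ d ∈ Finset.Ico 1 Y, chr D χ d * (Real.log d / d))| ≤ 2 * Y / y := by
    rw [Finset.mul_sum, ← Finset.sum_sub_distrib, ← Finset.sum_sub_distrib]
    refine (Finset.abs_sum_le_sum_abs _ _).trans ?_
    have : ∀ d ∈ Finset.Ico 1 Y, |chr D χ d * ((harmonic (y / d) : ℝ) / d) - 
        ((Real.log y + γ) * (chr D χ d * (d : ℝ)⁻¹) - chr D χ d * (Real.log d / d))| ≤ 2 / y := by
      intro d hd
      rw [Finset.mem_Ico] at hd
      have hdR : (0 : ℝ) < d := by exact_mod_cast (by omega : 0 < d)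
      have e : chr D χ d * ((harmonic (y / d) : ℝ) / d) - 
        ((Real.log y + γ) * (chr D χ d * (d : ℝ)⁻¹) - chr D χ d * (Real.log d / d)) =
        chr D χ d * (((harmonic (y / d) : ℝ) - (Real.log y - Real.log d + γ)) / d) := by
        field_simp; ring
      rw [e, abs_mul, abs_div, abs_of_pos hdR]
      have h5 := harmonic_approx y d (by omega) (by omega)
      have h6 : |(harmonic (y / d) : ℝ) - (Real.log y - Real.log d + γ)| / d ≤ 2 / y := by
        rw [div_le_iff₀ hdR]
        refine h5.trans (le_of_eq (by ring))
      have h7 := chr_abs_le χ d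
      calc _ ≤ 1 * (2 / (y : ℝ)) := mul_le_mul h7 h6 (by positivity) zero_le_one
        _ = _ := one_mul _
    refine (Finset.sum_le_card_nsmul _ _ _ this).trans ?_
    rw [Nat.card_Ico, nsmul_eq_mul, mul_div_assoc', mul_comm]
    have : ((Y - 1 : ℕ) : ℝ) ≤ Y := by exact_mod_cast Nat.sub_le Y 1
    gcongr
  have hγ0 : 0 ≤ Real.log y + γ := by
    have := Real.one_half_lt_eulerMascheroniConstant; linarith
  have hγ1 : Real.log y + γ ≤ Real.log y + 1 := by
    have := Real.eulerMascheroniConstant_lt_two_thirds; linarith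
  set S0 := ∑ d ∈ Finset.Ico 1 Y, chr D χ d * (d : ℝ)⁻¹ with hS0
  set S1 := ∑ d ∈ Finset.Ico 1 Y, chr D χ d * (Real.log d / d) with hS1
  have h8 : |(Real.log y + γ) * S0| ≤ (Real.log y + 1) * (ℓ + 2 * D / Y) := by
    rw [abs_mul, abs_of_nonneg hγ0]
    refine mul_le_mul hγ1 ?_ (abs_nonneg _) (by linarith)
    have : 2 * (D : ℝ) / Y = 2 * D * (Y : ℝ)⁻¹ := rfl
    rw [abs_le] at hL ⊢
    constructor <;> linarith
  have h9 : 2 * (D : ℝ) * (Real.log Y / Y) = 2 * D * Real.log Y / Y := by ring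
  rw [hsplit]
  rw [abs_le] at *
  constructor <;> linarith

theorem L'_bound {D : ℕ} [NeZero D] {χ : DirichletCharacter ℂ D} (hχ : χ ≠ 1)
    (h : ∀ a : ZMod D, (χ a).im = 0) (Y : ℕ) (hY : 3 ≤ Y) :
    |(deriv (DirichletCharacter.LFunction χ) 1).re| ≤ 
      2 * D * Real.log Y / Y + Real.log Y * (Real.log Y + 1) := by
  have hL' := L'_one_approx hχ h Y hY
  have hYR : (3 : ℝ) ≤ Y := by exact_mod_cast hY
  have : |∑ i ∈ Finset.range Y, chr D χ i * (Real.log i / i)| ≤ Real.log Y * (Real.log Y + 1) := by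
    refine (Finset.abs_sum_le_sum_abs _ _).trans ?_
    calc _ ≤ ∑ i ∈ Finset.range Y, Real.log Y * (i : ℝ)⁻¹ := by
          refine Finset.sum_le_sum fun i hi => ?_
          rcases Nat.eq_zero_or_pos i with rfl | hi0
          · simp
          have hiR : (1 : ℝ) ≤ i := by exact_mod_cast hi0
          have hiY : (i : ℝ) ≤ Y := by exact_mod_cast (Finset.mem_range.1 hi).le
          have hl := Real.log_le_log (by linarith) hiY
          have hl0 := Real.log_nonneg hiR
          rw [abs_mul, abs_of_nonneg (by positivity : 0 ≤ Real.log i / (i : ℝ)), div_eq_mul_inv]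
          calc _ ≤ 1 * (Real.log i * (i : ℝ)⁻¹) := mul_le_mul_of_nonneg_right (chr_abs_le χ i) (by positivity)
            _ ≤ _ := by rw [one_mul]; gcongr
      _ = Real.log Y * ∑ i ∈ Finset.range Y, (i : ℝ)⁻¹ := by rw [Finset.mul_sum]
      _ ≤ _ := by
          have hl0 := Real.log_nonneg (by linarith : (1 : ℝ) ≤ Y)
          refine mul_le_mul_of_nonneg_left ?_ hl0
          have h1 := harmonic_le_one_add_log Y
          have h2 : ∑ i ∈ Finset.range Y, (i : ℝ)⁻¹ ≤ harmonic Y := by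
            rw [harmonic_real, Finset.range_eq_Ico, Finset.sum_eq_sum_Ico_succ_bot (by omega)]
            simp only [Nat.cast_zero, inv_zero, zero_add]
            refine Finset.sum_le_sum_of_subset_of_nonneg ?_ fun _ _ _ => by positivity
            intro i hi
            simp only [Finset.mem_Ico, Finset.mem_Ioc] at hi ⊢
            omega
          linarith
  have h9 : 2 * (D : ℝ) * (Real.log Y / Y) = 2 * D * Real.log Y / Y := by ring
  rw [abs_le] at *
  constructor <;> linarith

/-- Indicator of nonzero squares. -/
def sqA : ArithmeticFunction ℝ := ⟨fun n => if n ≠ 0 ∧ IsSquare n then 1 else 0, by simp⟩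

/-- Indicator of squarefree divisors of `D`. -/
def eA (D : ℕ) : ArithmeticFunction ℝ :=
  ⟨fun n => if n ≠ 0 ∧ Squarefree n ∧ n ∣ D then 1 else 0, by simp⟩

theorem sqA_apply (n : ℕ) : sqA n = if n ≠ 0 ∧ IsSquare n then 1 else 0 := rfl

theorem eA_apply (D n : ℕ) : eA D n = if n ≠ 0 ∧ Squarefree n ∧ n ∣ D then 1 else 0 := rfl

theorem sqA_nonneg (n : ℕ) : 0 ≤ sqA n := by
  rw [sqA_apply]; split_ifs <;> norm_num

theorem eA_nonneg (D n : ℕ) : 0 ≤ eA D n := by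
  rw [eA_apply]; split_ifs <;> norm_num

theorem isSquare_mul_coprime {m n : ℕ} (h : m.Coprime n) :
    IsSquare (m * n) ↔ IsSquare m ∧ IsSquare n := by
  constructor
  · intro hs
    obtain ⟨r, hr⟩ := hs
    have h1 : m * n = r ^ 2 := by rw [hr, sq]
    have h2 : n * m = r ^ 2 := by rw [mul_comm, h1]
    refine ⟨?_, ?_⟩
    · obtain ⟨d, hd⟩ := exists_eq_pow_of_mul_eq_pow (by
        rw [Nat.isUnit_iff]; exact h) h1
      exact ⟨d, by rw [hd, sq]⟩
    · obtain ⟨d, hd⟩ := exists_eq_pow_of_mul_eq_pow (by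
        rw [Nat.isUnit_iff]; exact h.symm) h2
      exact ⟨d, by rw [hd, sq]⟩
  · rintro ⟨h1, h2⟩
    exact h1.mul h2

theorem sqA_mult : sqA.IsMultiplicative := by
  rw [ArithmeticFunction.IsMultiplicative.iff_ne_zero]
  refine ⟨by simp [sqA_apply], ?_⟩
  intro m n hm hn h
  have hs := isSquare_mul_coprime h
  rw [sqA_apply, sqA_apply, sqA_apply]
  by_cases h1 : IsSquare m <;> by_cases h2 : IsSquare n <;> simp [h1, h2, hm, hn, hs]

theorem eA_mult (D : ℕ) : (eA D).IsMultiplicative := by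
  rw [ArithmeticFunction.IsMultiplicative.iff_ne_zero]
  refine ⟨by simp [eA_apply], ?_⟩
  intro m n hm hn h
  have hd : m * n ∣ D ↔ m ∣ D ∧ n ∣ D :=
    ⟨fun h => ⟨(dvd_mul_right _ _).trans h, (dvd_mul_left _ _).trans h⟩,
      fun h' => h.mul_dvd_of_dvd_of_dvd h'.1 h'.2⟩
  have hs := Nat.squarefree_mul h
  rw [eA_apply, eA_apply, eA_apply]
  by_cases h1 : Squarefree m <;> by_cases h2 : Squarefree n <;> by_cases h3 : m ∣ D <;>
    by_cases h4 : n ∣ D <;> simp [h1, h2, h3, h4, hm, hn, hs, hd]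

theorem chr_mul {D : ℕ} {χ : DirichletCharacter ℂ D} (h : ∀ a : ZMod D, (χ a).im = 0) (m n : ℕ) :
    chr D χ (m * n) = chr D χ m * chr D χ n := by
  simp [chr, h]

theorem chr_one {D : ℕ} (χ : DirichletCharacter ℂ D) : chr D χ 1 = 1 := by simp [chr]

theorem chr_pow {D : ℕ} {χ : DirichletCharacter ℂ D} (h : ∀ a : ZMod D, (χ a).im = 0) (m k : ℕ) :
    chr D χ (m ^ k) = chr D χ m ^ k := by
  induction k with
  | zero => simp [chr_one]
  | succ k ih => rw [pow_succ, chr_mul h, ih, pow_succ]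

theorem chiA_mult {D : ℕ} {χ : DirichletCharacter ℂ D} (h : ∀ a : ZMod D, (χ a).im = 0) :
    (chiA D χ).IsMultiplicative := by
  rw [ArithmeticFunction.IsMultiplicative.iff_ne_zero]
  refine ⟨by simp [chiA, chr_one], ?_⟩
  intro m n hm hn _
  simp [chiA, hm, hn, chr_mul h]

theorem nuA_mult {D : ℕ} {χ : DirichletCharacter ℂ D} (h : ∀ a : ZMod D, (χ a).im = 0) :
    (nuA D χ).IsMultiplicative :=
  (chiA_mult h).mul ArithmeticFunction.isMultiplicative_zeta.natCast

theorem chr_prime {D : ℕ} {χ : DirichletCharacter ℂ D} (h : ∀ a : ZMod D, (χ a).im = 0)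
    {p : ℕ} (hp : p.Prime) : (p ∣ D ∧ chr D χ p = 0) ∨ (¬ p ∣ D ∧ (chr D χ p = 1 ∨ chr D χ p = -1)) := by
  by_cases hd : p ∣ D
  · left
    refine ⟨hd, ?_⟩
    have : ¬ IsUnit (p : ZMod D) := by
      rw [ZMod.isUnit_iff_coprime]
      intro hc
      exact hp.one_lt.ne' (Nat.Coprime.eq_one_of_dvd hc hd)
    simp [chr, χ.map_nonunit this]
  · right
    refine ⟨hd, ?_⟩
    have hu : IsUnit (p : ZMod D) := by
      rw [ZMod.isUnit_iff_coprime]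
      exact (hp.coprime_iff_not_dvd).2 hd
    have h1 : (χ ^ 2) (p : ZMod D) = 1 := by
      rw [sq_eq_one_of_real h]; exact MulChar.one_apply hu
    rw [MulChar.pow_apply' _ two_ne_zero, chr_coe h] at h1
    have h2 : chr D χ p ^ 2 = 1 := by exact_mod_cast h1
    have h3 : (chr D χ p - 1) * (chr D χ p + 1) = 0 := by ring_nf; linarith
    rcases mul_eq_zero.1 h3 with h4 | h4
    · left; linarith
    · right; linarith

theorem mul_prime_pow (f g : ArithmeticFunction ℝ) {p : ℕ} (hp : p.Prime) (k : ℕ) :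
    (f * g) (p ^ k) = ∑ i ∈ Finset.range (k + 1), f (p ^ i) * g (p ^ (k - i)) := by
  rw [ArithmeticFunction.mul_apply, Nat.sum_divisorsAntidiagonal (fun a b => f a * g b),
    Nat.sum_divisors_prime_pow hp]
  refine Finset.sum_congr rfl fun i hi => ?_
  rw [Nat.pow_div (by have := Finset.mem_range.1 hi; omega) hp.pos]

theorem nuA_prime_pow {D : ℕ} {χ : DirichletCharacter ℂ D} (h : ∀ a : ZMod D, (χ a).im = 0)
    {p : ℕ} (hp : p.Prime) (k : ℕ) :
    nuA D χ (p ^ k) = ∑ i ∈ Finset.range (k + 1), chr D χ p ^ i := by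
  rw [nuA_apply, Nat.sum_divisors_prime_pow hp]
  simp [chr_pow h]

theorem sqA_prime_pow {p : ℕ} (hp : p.Prime) (k : ℕ) : sqA (p ^ k) = if Even k then 1 else 0 := by
  rw [sqA_apply]
  have : IsSquare (p ^ k) ↔ Even k := by
    constructor
    · rintro ⟨r, hr⟩
      have := congrArg (fun n => n.factorization p) hr
      have hr0 : r ≠ 0 := by
        rintro rfl
        have := pow_pos hp.pos k
        omega
      simp only [hp.factorization_pow, Nat.factorization_mul hr0 hr0] at this
      simp at this
      exact ⟨_, this⟩
    · intro he; exact he.isSquare_pow p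
  simp [this, hp.ne_zero]

theorem eA_prime_pow (D : ℕ) {p : ℕ} (hp : p.Prime) (k : ℕ) :
    eA D (p ^ k) = if k = 0 then 1 else if k = 1 ∧ p ∣ D then 1 else 0 := by
  rw [eA_apply]
  rcases k with _ | _ | k
  · simp
  · simp [hp.ne_zero, hp.prime.squarefree]
  · have : ¬ Squarefree (p ^ (k + 1 + 1)) := by
      intro hs
      have := hs p ⟨p ^ k, by ring⟩
      exact hp.prime.not_unit this
    simp [this]

theorem two_step (f : ℕ → ℕ → ℝ) (k : ℕ) :
    ∑ i ∈ Finset.range (k + 2 + 1), f i (k + 2 - i) =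
      (∑ i ∈ Finset.range (k + 1), f (i + 2) (k - i)) + f 1 (k + 1) + f 0 (k + 2) := by
  rw [Finset.sum_range_succ', Finset.sum_range_succ']
  simp only [Nat.sub_zero, zero_add]
  congr 2
  refine Finset.sum_congr rfl fun i _ => ?_
  congr 1
  omega

theorem seq_identity (c : ℝ) (b : Prop) (hc : (b ∧ c = 0) ∨ (¬ b ∧ (c = 1 ∨ c = -1))) (v h : ℕ → ℝ)
    (hv : ∀ k, v k = ∑ i ∈ Finset.range (k + 1), c ^ i)
    (h0 : h 0 = v 0 * v 0) (h1 : ∀ k, h (k + 1) = v (k + 1) * v (k + 1) + if b then v k * v k else 0)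
    (k : ℕ) :
    ∑ i ∈ Finset.range (k + 1), (if Even i then (1 : ℝ) else 0) * h (k - i) =
      ∑ i ∈ Finset.range (k + 1), v i * v (k - i) := by
  have hv0 : v 0 = 1 := by simp [hv]
  have hvs : ∀ k, v (k + 1) = v k + c ^ (k + 1) := by
    intro k; rw [hv, Finset.sum_range_succ, ← hv]
  have key : ∀ k, ∑ i ∈ Finset.range (k + 2 + 1), v i * v (k + 2 - i) =
      ∑ i ∈ Finset.range (k + 1), v i * v (k - i) + h (k + 2) := by
    intro k
    rcases hc with ⟨hb, rfl⟩ | ⟨hb, rfl | rfl⟩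
    · have : ∀ k, v k = 1 := by
        intro k
        induction k with
        | zero => exact hv0
        | succ k ih => rw [hvs, ih]; simp
      simp [this, h1, hb]; ring
    · have hvk : ∀ k, v k = k + 1 := by
        intro k; rw [hv]; simp
      have hR : ∀ (n : ℕ) (m : ℕ), m ≤ n + 1 → ∑ i ∈ Finset.range m, v i * v (n - i) =
          (m : ℝ) * (m + 1) * (3 * n + 5 - 2 * m) / 6 := by
        intro n m
        induction m with
        | zero => simp
        | succ m ih =>
          intro hm
          rw [Finset.sum_range_succ, ih (by omega), hvk, hvk, Nat.cast_sub (by omega)]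
          push_cast
          ring
      rw [hR _ _ le_rfl, hR _ _ le_rfl, h1, hvk]
      simp [hb]
      ring
    · have hv2 : ∀ k, v (k + 2) = v k := by
        intro k; rw [hvs, hvs]; ring
      have hv1 : v 1 = 0 := by rw [hvs, hv0]; norm_num
      have hsq : ∀ k, v k * v k = v k := by
        intro k
        induction k using Nat.twoStepInduction with
        | zero => rw [hv0]; norm_num
        | one => rw [hv1]; norm_num
        | more n ih _ => rw [hv2]; exact ih
      rw [two_step (fun i j => v i * v j), h1]
      simp [hb, hv1, hv0, hv2, hsq]
  induction k using Nat.twoStepInduction with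
  | zero => simp [h0]
  | one =>
    simp [Finset.sum_range_succ, h1, hvs, hv0]
    rcases hc with ⟨hb, rfl⟩ | ⟨hb, rfl | rfl⟩ <;> simp [hb] <;> norm_num
  | more n ih _ =>
    rw [key, ← ih, two_step (fun i j => (if Even i then (1 : ℝ) else 0) * h j)]
    simp [Nat.even_add]

theorem main_identity {D : ℕ} {χ : DirichletCharacter ℂ D} (h : ∀ a : ZMod D, (χ a).im = 0) :
    sqA * (eA D * (nuA D χ).pmul (nuA D χ)) = nuA D χ * nuA D χ := by
  have hn := nuA_mult h
  have hnn : ((nuA D χ).pmul (nuA D χ)).IsMultiplicative := hn.pmul hn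
  rw [ArithmeticFunction.IsMultiplicative.eq_iff_eq_on_prime_powers _
    (sqA_mult.mul ((eA_mult D).mul hnn)) _ (hn.mul hn)]
  intro p k hp
  rw [mul_prime_pow _ _ hp, mul_prime_pow _ _ hp]
  simp only [sqA_prime_pow hp]
  refine seq_identity (chr D χ p) (p ∣ D) (chr_prime h hp) (fun k => nuA D χ (p ^ k))
    (fun k => (eA D * (nuA D χ).pmul (nuA D χ)) (p ^ k)) (nuA_prime_pow h hp) ?_ ?_ k
  · simp [mul_prime_pow _ _ hp, eA_apply]
  · intro k
    simp only [mul_prime_pow _ _ hp, eA_prime_pow D hp]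
    rw [Finset.sum_range_succ', Finset.sum_range_succ']
    rw [Finset.sum_eq_zero]
    · by_cases hd : p ∣ D <;> simp [hd, ArithmeticFunction.pmul_apply]
      ring
    · intro i _; simp

theorem nuA_nonneg {D : ℕ} {χ : DirichletCharacter ℂ D} (h : ∀ a : ZMod D, (χ a).im = 0) (n : ℕ) :
    0 ≤ nuA D χ n := by
  rcases eq_or_ne n 0 with rfl | hn
  · simp
  rw [(nuA_mult h).multiplicative_factorization _ hn]
  refine Finset.prod_nonneg fun p hp => ?_
  have hp : p.Prime := Nat.prime_of_mem_primeFactors hp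
  simp only [nuA_prime_pow h hp]
  rcases chr_prime h hp with ⟨_, h0⟩ | ⟨_, h0 | h0⟩
  · rw [h0]; exact Finset.sum_nonneg fun i _ => by positivity
  · rw [h0]; simp; positivity
  · rw [h0, neg_one_geom_sum]; split_ifs <;> norm_num

/-- The Euler factor at primes dividing `D`. -/
def PD (D : ℕ) : ℝ := ∏ q ∈ D.primeFactors, (1 + (q : ℝ)⁻¹)

theorem PD_ge (D : ℕ) : 1 ≤ PD D := by
  calc (1 : ℝ) = ∏ q ∈ D.primeFactors, (1 : ℝ) := by simp
    _ ≤ PD D := by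
      refine Finset.prod_le_prod (fun _ _ => zero_le_one) fun q _ => ?_
      have : (0 : ℝ) ≤ (q : ℝ)⁻¹ := by positivity
      linarith

theorem PD_eq {D : ℕ} (hD : D ≠ 0) :
    PD D = ∑ d ∈ D.divisors with Squarefree d, (d : ℝ)⁻¹ := by
  rw [Nat.sum_divisors_filter_squarefree hD, PD, Finset.prod_one_add]
  have : (UniqueFactorizationMonoid.normalizedFactors D).toFinset = D.primeFactors := by
    simp [Nat.factors_eq]
  rw [this]
  refine Finset.sum_congr rfl fun s _ => ?_
  rw [Finset.prod_inv_distrib]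
  congr 1
  rw [Finset.prod_val]
  push_cast
  rfl

theorem Wsum_eA_le {D : ℕ} (hD : D ≠ 0) (N : ℕ) : Wsum (eA D) N ≤ PD D := by
  rw [PD_eq hD, Wsum]
  have : ∑ n ∈ Finset.Ioc 0 N, wt (eA D) n =
      ∑ n ∈ (Finset.Ioc 0 N).filter (fun n => Squarefree n ∧ n ∣ D), (n : ℝ)⁻¹ := by
    rw [Finset.sum_filter]
    refine Finset.sum_congr rfl fun n hn => ?_
    have : n ≠ 0 := by have := Finset.mem_Ioc.1 hn; omega
    rw [wt_apply, eA_apply]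
    simp only [this, ne_eq, not_false_eq_true, true_and]
    split_ifs <;> simp
  rw [this]
  refine Finset.sum_le_sum_of_subset_of_nonneg ?_ fun _ _ _ => by positivity
  intro n hn
  simp at hn ⊢
  exact ⟨⟨hn.2.2, hD⟩, hn.2.1⟩

theorem Wsum_eA_ge {D : ℕ} (hD : D ≠ 0) : PD D ≤ Wsum (eA D) D := by
  rw [PD_eq hD, Wsum]
  have : ∑ d ∈ D.divisors with Squarefree d, (d : ℝ)⁻¹ =
      ∑ d ∈ D.divisors with Squarefree d, wt (eA D) d := by
    refine Finset.sum_congr rfl fun n hn => ?_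
    simp at hn
    have : n ≠ 0 := by rintro rfl; simp at hn
    rw [wt_apply, eA_apply]
    simp [this, hn]
  rw [this]
  refine Finset.sum_le_sum_of_subset_of_nonneg ?_ fun _ _ _ => wt_nonneg (eA_nonneg D) _
  intro n hn
  simp at hn ⊢
  exact ⟨Nat.pos_of_dvd_of_pos hn.1.1 (Nat.pos_of_ne_zero hD), Nat.le_of_dvd (Nat.pos_of_ne_zero hD) hn.1.1⟩

theorem Wsum_sqA_le (N : ℕ) : Wsum sqA N ≤ Real.pi ^ 2 / 6 := by
  have h1 : Wsum sqA N ≤ ∑ m ∈ Finset.range (N + 1), 1 / (m : ℝ) ^ 2 := by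
    have : ∑ m ∈ Finset.range (N + 1), 1 / (m : ℝ) ^ 2 =
        ∑ n ∈ (Finset.range (N + 1)).image (fun m : ℕ => m ^ 2), (n : ℝ)⁻¹ := by
      rw [Finset.sum_image]
      · simp
      · intro a _ b _ hab
        exact Nat.pow_left_injective (n := 2) (by norm_num) hab
    rw [this, Wsum]
    have h2 : ∑ n ∈ Finset.Ioc 0 N, wt sqA n =
      ∑ n ∈ (Finset.Ioc 0 N).filter (fun n => IsSquare n), (n : ℝ)⁻¹ := by
      rw [Finset.sum_filter]
      refine Finset.sum_congr rfl fun n hn => ?_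
      have : n ≠ 0 := by have := Finset.mem_Ioc.1 hn; omega
      rw [wt_apply, sqA_apply]
      simp only [this, ne_eq, not_false_eq_true, true_and]
      split_ifs <;> simp
    rw [h2]
    refine Finset.sum_le_sum_of_subset_of_nonneg ?_ fun _ _ _ => by positivity
    intro n hn
    simp at hn ⊢
    obtain ⟨⟨h0, hN⟩, r, rfl⟩ := hn
    exact ⟨r, by nlinarith [Nat.le_mul_self r], by ring⟩
  exact h1.trans (sum_le_hasSum _ (fun _ _ => by positivity) hasSum_zeta_two)

theorem Wsum_sqA_ge (D : ℕ) (hD : 1 ≤ D) : Real.pi ^ 2 / 6 - 1 / D ≤ Wsum sqA (D ^ 2) := by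
  have h1 : ∑ m ∈ Finset.Ioc 0 D, 1 / (m : ℝ) ^ 2 ≤ Wsum sqA (D ^ 2) := by
    have : ∑ m ∈ Finset.Ioc 0 D, 1 / (m : ℝ) ^ 2 =
        ∑ n ∈ (Finset.Ioc 0 D).image (fun m : ℕ => m ^ 2), wt sqA n := by
      rw [Finset.sum_image]
      · refine Finset.sum_congr rfl fun n hn => ?_
        have : n ≠ 0 := by have := Finset.mem_Ioc.1 hn; omega
        rw [wt_apply, sqA_apply, if_pos ⟨by positivity, IsSquare.sq n⟩]
        push_cast
        rfl
      · intro a _ b _ hab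
        exact Nat.pow_left_injective (n := 2) (by norm_num) hab
    rw [this, Wsum]
    refine Finset.sum_le_sum_of_subset_of_nonneg ?_ fun _ _ _ => wt_nonneg sqA_nonneg _
    intro n hn
    simp only [Finset.mem_image, Finset.mem_Ioc] at hn ⊢
    obtain ⟨r, ⟨h0, hN⟩, rfl⟩ := hn
    exact ⟨by positivity, Nat.pow_le_pow_left hN 2⟩
  refine le_trans ?_ h1
  have htail : ∀ N, D ≤ N → ∑ m ∈ Finset.range (N + 1), 1 / (m : ℝ) ^ 2 ≤
      ∑ m ∈ Finset.Ioc 0 D, 1 / (m : ℝ) ^ 2 + (1 / (D : ℝ) - 1 / (N : ℝ)) := by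
    intro N hN
    induction N, hN using Nat.le_induction with
    | base =>
      rw [Finset.range_eq_Ico, Finset.sum_eq_sum_Ico_succ_bot (by omega)]
      simp
      exact le_refl _
    | succ N hN ih =>
      rw [Finset.sum_range_succ]
      have hN0 : (0 : ℝ) < N := by exact_mod_cast (by omega : 0 < N)
      have : 1 / ((N + 1 : ℕ) : ℝ) ^ 2 ≤ 1 / N - 1 / ((N + 1 : ℕ) : ℝ) := by
        push_cast
        rw [div_sub_div _ _ hN0.ne' (by positivity), div_le_div_iff₀ (by positivity) (by positivity)]
        nlinarith
      linarith
  have hlim := hasSum_zeta_two.tendsto_sum_nat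
  have hle : Real.pi ^ 2 / 6 ≤ ∑ m ∈ Finset.Ioc 0 D, 1 / (m : ℝ) ^ 2 + 1 / D := by
    refine le_of_tendsto hlim ?_
    filter_upwards [Filter.eventually_ge_atTop (D + 1)] with n hn
    obtain ⟨m, rfl⟩ : ∃ m, n = m + 1 := ⟨n - 1, by omega⟩
    have := htail m (by omega)
    have h0 : (0 : ℝ) ≤ 1 / m := by positivity
    linarith
  linarith

theorem bracket_lo {D : ℕ} (hD : 2 ≤ D) {χ : DirichletCharacter ℂ D} (h : ∀ a : ZMod D, (χ a).im = 0) :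
    Wsum (nuA D χ) (D ^ 2 - 1) ^ 2 ≤
      (Real.pi ^ 2 / 6 * PD D) * Wsum ((nuA D χ).pmul (nuA D χ)) (D ^ 4 - 1) := by
  have hn := nuA_nonneg h
  have hnn : ∀ n, 0 ≤ ((nuA D χ).pmul (nuA D χ)) n := fun n => mul_nonneg (hn n) (hn n)
  have hle : (D ^ 2 - 1) * (D ^ 2 - 1) ≤ D ^ 4 - 1 := by
    have h1 : 1 ≤ D ^ 2 := Nat.one_le_pow _ _ (by omega)
    obtain ⟨m, hm⟩ : ∃ m, D ^ 2 = m + 1 := ⟨D ^ 2 - 1, by omega⟩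
    have h4 : D ^ 4 = (m + 1) * (m + 1) := by rw [← hm]; ring
    rw [h4, hm]
    have : (m + 1) * (m + 1) = m * m + (2 * m + 1) := by ring
    rw [this]
    simp only [Nat.add_sub_cancel]
    omega
  calc Wsum (nuA D χ) (D ^ 2 - 1) ^ 2 = _ := sq _
    _ ≤ Wsum (nuA D χ * nuA D χ) (D ^ 4 - 1) := Wsum_mul_ge hn hn _ _ _ hle
    _ = Wsum (sqA * (eA D * (nuA D χ).pmul (nuA D χ))) (D ^ 4 - 1) := by rw [main_identity h]
    _ ≤ Wsum sqA (D ^ 4 - 1) * Wsum (eA D * (nuA D χ).pmul (nuA D χ)) (D ^ 4 - 1) := by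
        refine Wsum_mul_le sqA_nonneg (fun n => ?_) _
        rw [ArithmeticFunction.mul_apply]
        exact Finset.sum_nonneg fun x _ => mul_nonneg (eA_nonneg D _) (hnn _)
    _ ≤ (Real.pi ^ 2 / 6) * (PD D * Wsum ((nuA D χ).pmul (nuA D χ)) (D ^ 4 - 1)) := by
        have h0 : 0 ≤ Wsum ((nuA D χ).pmul (nuA D χ)) (D ^ 4 - 1) := Wsum_nonneg hnn _
        have h1 : Wsum (eA D * (nuA D χ).pmul (nuA D χ)) (D ^ 4 - 1) ≤
            PD D * Wsum ((nuA D χ).pmul (nuA D χ)) (D ^ 4 - 1) :=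
          (Wsum_mul_le (eA_nonneg D) hnn _).trans
            (mul_le_mul_of_nonneg_right (Wsum_eA_le (by omega) _) h0)
        refine mul_le_mul (Wsum_sqA_le _) h1 ?_ (by positivity)
        refine Wsum_nonneg (fun n => ?_) _
        rw [ArithmeticFunction.mul_apply]
        exact Finset.sum_nonneg fun x _ => mul_nonneg (eA_nonneg D _) (hnn _)
    _ = _ := by ring

theorem bracket_hi {D : ℕ} (hD : 2 ≤ D) {χ : DirichletCharacter ℂ D} (h : ∀ a : ZMod D, (χ a).im = 0) :
    (Real.pi ^ 2 / 6 * PD D) * Wsum ((nuA D χ).pmul (nuA D χ)) (D ^ 4 - 1) ≤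
      Wsum (nuA D χ) (D ^ 7) ^ 2 * (1 + 1 / D) := by
  have hn := nuA_nonneg h
  have hnn : ∀ n, 0 ≤ ((nuA D χ).pmul (nuA D χ)) n := fun n => mul_nonneg (hn n) (hn n)
  have hen : ∀ n, 0 ≤ (eA D * (nuA D χ).pmul (nuA D χ)) n := by
    intro n
    rw [ArithmeticFunction.mul_apply]
    exact Finset.sum_nonneg fun x _ => mul_nonneg (eA_nonneg D _) (hnn _)
  set T := Wsum ((nuA D χ).pmul (nuA D χ)) (D ^ 4 - 1) with hT
  have h0 : 0 ≤ T := Wsum_nonneg hnn _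
  have hP := PD_ge D
  have hDR : (2 : ℝ) ≤ D := by exact_mod_cast hD
  have hpi := Real.pi_gt_three
  have hZ : 3 / 2 ≤ Real.pi ^ 2 / 6 := by nlinarith
  have hD2 : 1 / (D : ℝ) ≤ 1 / 2 := by
    rw [div_le_div_iff₀ (by linarith) (by norm_num)]; linarith
  have key : (Real.pi ^ 2 / 6 - 1 / D) * (PD D * T) ≤ Wsum (nuA D χ) (D ^ 7) ^ 2 := by
    calc (Real.pi ^ 2 / 6 - 1 / D) * (PD D * T) ≤
        Wsum sqA (D ^ 2) * Wsum (eA D * (nuA D χ).pmul (nuA D χ)) (D ^ 5) := by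
          refine mul_le_mul (Wsum_sqA_ge D (by omega)) ?_ (by positivity) (Wsum_nonneg sqA_nonneg _)
          refine (mul_le_mul_of_nonneg_right (Wsum_eA_ge (by omega)) h0).trans ?_
          refine Wsum_mul_ge (eA_nonneg D) hnn _ _ _ ?_
          calc D * (D ^ 4 - 1) ≤ D * D ^ 4 := Nat.mul_le_mul_left _ (Nat.sub_le _ _)
            _ = D ^ 5 := by ring
      _ ≤ Wsum (sqA * (eA D * (nuA D χ).pmul (nuA D χ))) (D ^ 7) :=
          Wsum_mul_ge sqA_nonneg hen _ _ _ (by rw [← pow_add])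
      _ = Wsum (nuA D χ * nuA D χ) (D ^ 7) := by rw [main_identity h]
      _ ≤ _ := by rw [sq]; exact Wsum_mul_le hn hn _
  have hPT : 0 ≤ PD D * T := by positivity
  have h2 : PD D * T ≤ Wsum (nuA D χ) (D ^ 7) ^ 2 := by nlinarith
  have h3 : 1 / (D : ℝ) * (PD D * T) ≤ 1 / D * Wsum (nuA D χ) (D ^ 7) ^ 2 :=
    mul_le_mul_of_nonneg_left h2 (by positivity)
  nlinarith

theorem S_est {D : ℕ} [NeZero D] {χ : DirichletCharacter ℂ D} (hχ : χ ≠ 1)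
    (h : ∀ a : ZMod D, (χ a).im = 0) (hD : 9 ≤ D) (s : ℕ) (hs : 1 ≤ s) (hsD : s * s ≤ D) (y : ℕ)
    (hy1 : D ^ 2 - 1 ≤ y) (hy2 : y ≤ D ^ 7) (hu : 1 ≤ Real.log D) :
    |Wsum (nuA D χ) y - (deriv (DirichletCharacter.LFunction χ) 1).re| ≤
      8 * Real.log D * (DirichletCharacter.LFunction χ 1).re + 40 * Real.log D * (1 / s) := by
  have hDR : (9 : ℝ) ≤ D := by exact_mod_cast hD
  have hsR : (1 : ℝ) ≤ s := by exact_mod_cast hs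
  have hsDR : (s : ℝ) * s ≤ D := by exact_mod_cast hsD
  have hsltD : s < D := by nlinarith
  have hYy : D * s ≤ y := by
    refine le_trans ?_ hy1
    have : D * s + D ≤ D ^ 2 := by nlinarith
    omega
  have hY3 : 3 ≤ D * s := by nlinarith
  have hest := Wsum_nuA_approx hχ h y (D * s) hY3 hYy
  have hl := L_nonneg hχ h
  set ℓ := (DirichletCharacter.LFunction χ 1).re
  set u := Real.log D with hudef
  have hy0 : 0 < y := by omega
  have hyR : (0 : ℝ) < y := by exact_mod_cast hy0
  have hlogy : Real.log y ≤ 7 * u := by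
    have : Real.log y ≤ Real.log ((D : ℝ) ^ 7) := Real.log_le_log hyR (by exact_mod_cast hy2)
    rwa [Real.log_pow] at this
  have hlogY : Real.log (D * s : ℕ) ≤ 2 * u := by
    have : Real.log (D * s : ℕ) ≤ Real.log ((D : ℝ) ^ 2) := by
      refine Real.log_le_log (by exact_mod_cast (by omega : 0 < D * s)) ?_
      push_cast
      have : (s : ℝ) ≤ D := by exact_mod_cast hsltD.le
      nlinarith
    rwa [Real.log_pow] at this
  have e1 : 2 * (D : ℝ) / (D * s : ℕ) = 2 * (1 / s) := by
    push_cast; field_simp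
  have e2 : 2 * (D : ℝ) * Real.log (D * s : ℕ) / (D * s : ℕ) = 2 * Real.log (D * s : ℕ) * (1 / s) := by
    generalize Real.log (D * s : ℕ) = L
    push_cast; field_simp
  have e3 : 2 * (D : ℝ) * (Real.log y + 1) / (D * s : ℕ) = 2 * (Real.log y + 1) * (1 / s) := by
    push_cast; field_simp
  have e4 : 2 * ((D * s : ℕ) : ℝ) / y ≤ 4 * (1 / s) := by
    have hyD : (D : ℝ) ^ 2 ≤ y + 1 := by exact_mod_cast (by omega : D ^ 2 ≤ y + 1)
    push_cast
    rw [mul_one_div, div_le_div_iff₀ hyR (by linarith)]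
    nlinarith
  rw [e2, e3, e1] at hest
  set w : ℝ := 1 / (s : ℝ) with hw
  have hw0 : 0 < w := by positivity
  have a1 : (Real.log y + 1) * (ℓ + 2 * w) ≤ 8 * u * (ℓ + 2 * w) :=
    mul_le_mul_of_nonneg_right (by linarith) (by positivity)
  have a2 : 2 * Real.log (D * s : ℕ) * w ≤ 4 * u * w :=
    mul_le_mul_of_nonneg_right (by linarith) hw0.le
  have a3 : 2 * (Real.log y + 1) * w ≤ 16 * u * w :=
    mul_le_mul_of_nonneg_right (by linarith) hw0.le
  have a4 : 4 * w ≤ 4 * u * w := mul_le_mul_of_nonneg_right (by linarith) hw0.le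
  linarith

theorem L'_est {D : ℕ} [NeZero D] {χ : DirichletCharacter ℂ D} (hχ : χ ≠ 1)
    (h : ∀ a : ZMod D, (χ a).im = 0) (hD : 9 ≤ D) (hu : 1 ≤ Real.log D) :
    |(deriv (DirichletCharacter.LFunction χ) 1).re| ≤ 10 * Real.log D ^ 2 := by
  have hb := L'_bound hχ h D (by omega)
  have hDR : (9 : ℝ) ≤ D := by exact_mod_cast hD
  have : 2 * (D : ℝ) * Real.log D / D = 2 * Real.log D := by field_simp
  rw [this] at hb
  nlinarith

theorem real_core (u w l S₁ S₂ G T lp d ε : ℝ) (hu : 1 ≤ u) (hw : w = (u ^ 10)⁻¹)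
    (hl0 : 0 ≤ l) (hl : l ≤ w) (hlp : |lp| ≤ 10 * u ^ 2) (hd : 0 ≤ d) (hdw : d ≤ w)
    (h1 : |S₁ - lp| ≤ 48 * u * w) (h2 : |S₂ - lp| ≤ 48 * u * w) (hG : 1 ≤ G)
    (hlo : S₁ ^ 2 ≤ G * T) (hhi : G * T ≤ S₂ ^ 2 * (1 + d)) (hε : 6628 < ε * u) :
    |T - lp ^ 2 / G| < ε := by
  have hu0 : 0 < u := by linarith
  have hw0 : 0 < w := by rw [hw]; positivity
  have huw : u ^ 10 * w = 1 := by rw [hw]; field_simp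
  have huw1 : u * w ≤ 1 := by
    calc u * w ≤ u ^ 10 * w := mul_le_mul_of_nonneg_right (le_self_pow₀ hu (by norm_num)) hw0.le
      _ = 1 := huw
  have hu5 : u ^ 4 * w * u ≤ 1 := by
    calc u ^ 4 * w * u = u ^ 5 * w := by ring
      _ ≤ u ^ 10 * w := mul_le_mul_of_nonneg_right (pow_le_pow_right₀ hu (by norm_num)) hw0.le
      _ = 1 := huw
  have hu2 : 1 ≤ u ^ 2 := one_le_pow₀ hu
  have hu34 : u ^ 3 * w ≤ u ^ 4 * w :=
    mul_le_mul_of_nonneg_right (pow_le_pow_right₀ hu (by norm_num)) hw0.le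
  have sqd : ∀ S : ℝ, |S - lp| ≤ 48 * u * w → |S ^ 2 - lp ^ 2| ≤ 3264 * (u ^ 4 * w) := by
    intro S hS
    have e : S ^ 2 - lp ^ 2 = (S - lp) * ((S - lp) + 2 * lp) := by ring
    rw [e, abs_mul]
    have h3 : |(S - lp) + 2 * lp| ≤ 68 * u ^ 2 := by
      refine (abs_add_le _ _).trans ?_
      rw [abs_mul, abs_two]
      linarith
    calc |S - lp| * |S - lp + 2 * lp| ≤ (48 * u * w) * (68 * u ^ 2) :=
          mul_le_mul hS h3 (abs_nonneg _) (by positivity)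
      _ = 3264 * (u ^ 3 * w) := by ring
      _ ≤ _ := by linarith
  have hS2 : S₂ ^ 2 ≤ 3364 * u ^ 4 := by
    have : |S₂| ≤ 58 * u ^ 2 := by
      have : S₂ = (S₂ - lp) + lp := by ring
      rw [this]
      refine (abs_add_le _ _).trans ?_
      linarith
    calc S₂ ^ 2 = |S₂| ^ 2 := (sq_abs _).symm
      _ ≤ (58 * u ^ 2) ^ 2 := pow_le_pow_left₀ (abs_nonneg _) this 2
      _ = _ := by ring
  have hS2d : S₂ ^ 2 * d ≤ 3364 * (u ^ 4 * w) := by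
    calc S₂ ^ 2 * d ≤ (3364 * u ^ 4) * w := mul_le_mul hS2 hdw hd (by positivity)
      _ = _ := by ring
  have b1 := abs_le.1 (sqd S₁ h1)
  have b2 := abs_le.1 (sqd S₂ h2)
  have hpos : 0 < u ^ 4 * w := by positivity
  have hfin : 6628 * (u ^ 4 * w) < ε := by
    have : 6628 * (u ^ 4 * w) * u < ε * u := by nlinarith
    exact lt_of_mul_lt_mul_right this hu0.le
  have hGT : |G * T - lp ^ 2| < ε := by
    rw [abs_lt]; constructor <;> nlinarith
  have e : T - lp ^ 2 / G = (G * T - lp ^ 2) / G := by field_simp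
  rw [e, abs_div, abs_of_pos (by linarith : 0 < G)]
  exact lt_of_le_of_lt (div_le_self (abs_nonneg _) hG) hGT

theorem eventually_large (ε : ℝ) (hε : 0 < ε) : ∃ D₀ : ℕ, ∀ D : ℕ, D₀ ≤ D →
    9 ≤ D ∧ 1 ≤ Real.log D ∧ 6628 < ε * Real.log D ∧ 4 * Real.log D ^ 20 ≤ D := by
  have t : Filter.Tendsto (fun n : ℕ => Real.log (n : ℝ)) Filter.atTop Filter.atTop :=
    Real.tendsto_log_atTop.comp tendsto_natCast_atTop_atTop
  have h4 : ∀ᶠ n : ℕ in Filter.atTop, 4 * Real.log (n : ℝ) ^ 20 ≤ n := by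
    have := (Real.isLittleO_pow_log_id_atTop (n := 20)).bound (by norm_num : (0 : ℝ) < 1 / 4)
    filter_upwards [tendsto_natCast_atTop_atTop.eventually this] with n hn
    simp only [id, Real.norm_eq_abs, Nat.abs_cast] at hn
    have := le_abs_self (Real.log (n : ℝ) ^ 20)
    linarith
  have := (Filter.eventually_ge_atTop 9).and ((t.eventually_ge_atTop 1).and
    ((t.eventually_gt_atTop (6628 / ε)).and h4))
  obtain ⟨D₀, hD₀⟩ := Filter.eventually_atTop.1 this
  refine ⟨D₀, fun D hD => ?_⟩
  obtain ⟨a, b, c, d⟩ := hD₀ D hD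
  refine ⟨a, b, ?_, d⟩
  rw [div_lt_iff₀ hε] at c
  linarith

theorem final_real (ε : ℝ) (hε : 0 < ε) : ∃ D₀ : ℕ, ∀ D : ℕ, D₀ ≤ D →
    9 ≤ D ∧ ∀ (_ : NeZero D) (χ : DirichletCharacter ℂ D), χ ≠ 1 → (∀ a : ZMod D, (χ a).im = 0) →
    (DirichletCharacter.LFunction χ 1).re < Real.log D ^ (-2022 : ℤ) →
    |Wsum ((nuA D χ).pmul (nuA D χ)) (D ^ 4 - 1) -
      (deriv (DirichletCharacter.LFunction χ) 1).re ^ 2 / (Real.pi ^ 2 / 6 * PD D)| < ε := by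
  obtain ⟨D₀, hD₀⟩ := eventually_large ε hε
  refine ⟨D₀, fun D hD => ?_⟩
  obtain ⟨hD9, hu, huε, h20⟩ := hD₀ D hD
  refine ⟨hD9, fun _ χ hχ h hA => ?_⟩
  have hDR : (9 : ℝ) ≤ D := by exact_mod_cast hD9
  set u := Real.log D with hudef
  set s := Nat.sqrt D with hs
  have hu0 : 0 < u := by linarith
  have hsD : s * s ≤ D := Nat.sqrt_le D
  have hs1 : 1 ≤ s := by
    rw [hs, Nat.le_sqrt]; omega
  have hsDR : (s : ℝ) * s ≤ D := by exact_mod_cast hsD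
  have hsR : (1 : ℝ) ≤ s := by exact_mod_cast hs1
  have hsu : u ^ 10 ≤ s := by
    have h1 : (D : ℝ) < (s + 1) * (s + 1) := by exact_mod_cast Nat.lt_succ_sqrt D
    have h2 : (2 * u ^ 10) ^ 2 < (2 * (s : ℝ)) ^ 2 := by nlinarith
    have := lt_of_pow_lt_pow_left₀ 2 (by positivity) h2
    linarith
  have hsw : 1 / (s : ℝ) ≤ (u ^ 10)⁻¹ := by
    rw [one_div]; exact inv_anti₀ (by positivity) hsu
  have hdw : 1 / (D : ℝ) ≤ (u ^ 10)⁻¹ := by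
    rw [one_div]; exact inv_anti₀ (by positivity) (by nlinarith)
  have hl0 := L_nonneg hχ h
  have hl : (DirichletCharacter.LFunction χ 1).re ≤ (u ^ 10)⁻¹ := by
    refine hA.le.trans ?_
    have : u ^ (-2022 : ℤ) ≤ u ^ (-10 : ℤ) := zpow_le_zpow_right₀ hu (by norm_num)
    refine this.trans (le_of_eq ?_)
    rw [zpow_neg]; rfl
  have est : ∀ y, D ^ 2 - 1 ≤ y → y ≤ D ^ 7 →
      |Wsum (nuA D χ) y - (deriv (DirichletCharacter.LFunction χ) 1).re| ≤ 48 * u * (u ^ 10)⁻¹ := by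
    intro y hy1 hy2
    have := S_est hχ h hD9 s hs1 hsD y hy1 hy2 hu
    refine this.trans ?_
    have a1 : 8 * u * (DirichletCharacter.LFunction χ 1).re ≤ 8 * u * (u ^ 10)⁻¹ :=
      mul_le_mul_of_nonneg_left hl (by positivity)
    have a2 : 40 * u * (1 / (s : ℝ)) ≤ 40 * u * (u ^ 10)⁻¹ :=
      mul_le_mul_of_nonneg_left hsw (by positivity)
    linarith
  have h27 : D ^ 2 ≤ D ^ 7 := Nat.pow_le_pow_right (by omega) (by norm_num)
  have hP := PD_ge D
  have hpi := Real.pi_gt_three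
  have hZ : 1 ≤ Real.pi ^ 2 / 6 := by nlinarith
  exact real_core u _ _ (Wsum (nuA D χ) (D ^ 2 - 1)) (Wsum (nuA D χ) (D ^ 7)) _ _ _ (1 / D) ε hu rfl
    hl0 hl (L'_est hχ h hD9 hu) (by positivity) hdw (est _ le_rfl (by omega))
    (est _ (by omega) le_rfl) (by nlinarith) (bracket_lo (by omega) h) (bracket_hi (by omega) h) huε

theorem sum_cast {D : ℕ} (hD : 1 ≤ D) {χ : DirichletCharacter ℂ D} (h : ∀ a : ZMod D, (χ a).im = 0) :
    ∑ n ∈ Finset.range (D ^ 4), nuF D χ n ^ 2 / (n : ℂ) =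
      ((Wsum ((nuA D χ).pmul (nuA D χ)) (D ^ 4 - 1) : ℝ) : ℂ) := by
  have h1 : 1 ≤ D ^ 4 := Nat.one_le_pow _ _ (by omega)
  have hnu : ∀ n, nuF D χ n = ((nuA D χ n : ℝ) : ℂ) := by
    intro n
    rw [nuF, nuA_apply]
    push_cast
    exact Finset.sum_congr rfl fun d _ => chr_coe h d
  rw [Wsum]
  push_cast
  rw [Finset.range_eq_Ico, Finset.sum_eq_sum_Ico_succ_bot (by omega)]
  simp only [CharP.cast_eq_zero, div_zero, zero_add]
  refine Finset.sum_congr ?_ fun n _ => ?_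
  · ext n; simp only [Finset.mem_Ico, Finset.mem_Ioc]; omega
  · rw [wt_apply, hnu, ArithmeticFunction.pmul_apply]
    push_cast
    ring

theorem fraka_cast {D : ℕ} [hD : NeZero D] {χ : DirichletCharacter ℂ D} (hχ : χ ≠ 1)
    (h : ∀ a : ZMod D, (χ a).im = 0) :
    fraka D χ = (((deriv (DirichletCharacter.LFunction χ) 1).re ^ 2 / (Real.pi ^ 2 / 6 * PD D) : ℝ) : ℂ) := by
  have hL : Lfun χ = DirichletCharacter.LFunction χ := by
    funext s
    rw [Lfun, dif_neg hD.ne]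
  have hd : deriv (DirichletCharacter.LFunction χ) 1 =
      ((deriv (DirichletCharacter.LFunction χ) 1).re : ℂ) := by
    apply Complex.ext
    · simp
    · simpa using L'_im hχ h
  have hp : ∏ q ∈ D.primeFactors, (q : ℂ) / ((q : ℂ) + 1) = (((PD D)⁻¹ : ℝ) : ℂ) := by
    rw [PD, ← Finset.prod_inv_distrib]
    push_cast
    refine Finset.prod_congr rfl fun q hq => ?_
    have : (q : ℂ) ≠ 0 := by exact_mod_cast (Nat.prime_of_mem_primeFactors hq).ne_zero
    rw [← inv_div]
    congr 1
    field_simp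
  rw [fraka, hL, hp, hd]
  push_cast
  simp only [Complex.ofReal_re]
  have : (Real.pi : ℂ) ≠ 0 := by exact_mod_cast Real.pi_ne_zero
  field_simp

/-- Under (A), `∑_{n < D⁴} ν(n)²/n = 𝔞 + o(1)`. -/
theorem statement19 :
    ∀ ε : ℝ, 0 < ε → ∃ D₀ : ℕ, ∀ D : ℕ, D₀ ≤ D → ∀ χ : DirichletCharacter ℂ D,
      IsRealChar χ → χ.IsPrimitive → AssumptionA D χ →
        ‖(∑ n ∈ Finset.range (D ^ 4), nuF D χ n ^ 2 / (n : ℂ)) - fraka D χ‖ < ε := by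
  intro ε hε
  obtain ⟨D₀, hD₀⟩ := final_real ε hε
  refine ⟨D₀, fun D hD χ hreal hprim hA => ?_⟩
  obtain ⟨h9, hmain⟩ := hD₀ D hD
  haveI : NeZero D := ⟨by omega⟩
  have hχ : χ ≠ 1 := by
    rintro rfl
    have h1 : (1 : DirichletCharacter ℂ D).conductor = D := hprim
    rw [DirichletCharacter.conductor_one] at h1
    omega
  have hL : Lfun χ 1 = DirichletCharacter.LFunction χ 1 := by
    rw [Lfun, dif_neg (by omega)]
  have hA' : (DirichletCharacter.LFunction χ 1).re < Real.log D ^ (-2022 : ℤ) := by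
    rw [← hL]; exact hA
  have := hmain ‹_› χ hχ hreal hA'
  rw [sum_cast (by omega) hreal, fraka_cast hχ hreal, ← Complex.ofReal_sub, Complex.norm_real]
  exact this


end
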